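/- (Double-Rayleigh plus LOS PDF) Let γ̄ > 0 and 0 < β < 1. Then for 0 < γ < β γ̄: ∫₀^∞ (1/((1-β) x γ̄)) e^{-(γ + β γ̄)/((1-β) x γ̄)} I₀( (2/((1-β) x)) √(β γ / γ̄) ) e^{-x} dx = (2/((1-β) γ̄)) I₀( 2√(γ/((1-β) γ̄)) ) K₀( 2√(β/(1-β)) ); and for γ > β γ̄ the same integral equals (2/((1-β) γ̄)) K₀( 2√(γ/((1-β) γ̄)) ) I₀( 2√(β/(1-β)) ). -/

import Mathlib

open MeasureTheory Real

/-- Modified Bessel function of the first kind and order zero: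
`I₀(z) = ∑_{k=0}^∞ (z²/4)^k / (k!)²`. -/
noncomputable def besselI0 (z : ℝ) : ℝ :=
  ∑' k : ℕ, (z ^ 2 / 4) ^ k / ((Nat.factorial k : ℝ)) ^ 2

/-- Modified Bessel function of the second kind and order zero:
`K₀(z) = ∫₀^∞ e^{-z cosh t} dt`. -/
noncomputable def besselK0 (z : ℝ) : ℝ :=
  ∫ t in Set.Ioi (0 : ℝ), Real.exp (-z * Real.cosh t)

/-- power series -/
noncomputable def dps (c : ℕ → ℝ) (w : ℝ) : ℝ := ∑' k : ℕ, c k * w ^ k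

lemma dps_summable (c : ℕ → ℝ) (hc : ∀ k, |c k| ≤ 1 / (k.factorial : ℝ)) (w : ℝ) :
    Summable (fun k => c k * w ^ k) := by
  refine Summable.of_norm_bounded (Real.summable_pow_div_factorial |w|) ?_
  intro k
  rw [norm_mul, norm_pow, Real.norm_eq_abs, Real.norm_eq_abs, div_eq_mul_one_div, mul_comm]
  exact mul_le_mul_of_nonneg_left (hc k) (by positivity)

lemma dps_hasDerivAt (c d : ℕ → ℝ) (hc : ∀ k, |c k| ≤ 1 / (k.factorial : ℝ))
    (hd : ∀ k, d k = c (k+1) * (k+1)) (w : ℝ) : HasDerivAt (dps c) (dps d w) w := by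
  have hb : Summable (fun n : ℕ => 1 / (n.factorial : ℝ) * (n * (|w| + 1) ^ (n - 1))) := by
    rw [← summable_nat_add_iff 1]
    refine (Real.summable_pow_div_factorial (|w| + 1)).congr ?_
    intro n
    rw [Nat.factorial_succ]
    push_cast
    have : (n.factorial : ℝ) ≠ 0 := by positivity
    have : (n : ℝ) + 1 ≠ 0 := by positivity
    field_simp
  have hbd : ∀ (n : ℕ) (y : ℝ), y ∈ Metric.ball (0:ℝ) (|w| + 1) →
      ‖c n * (n * y ^ (n - 1))‖ ≤ 1 / (n.factorial : ℝ) * (n * (|w| + 1) ^ (n - 1)) := by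
    intro n y hy
    rw [mem_ball_zero_iff, Real.norm_eq_abs] at hy
    rw [norm_mul, norm_mul, norm_pow, Real.norm_eq_abs, Real.norm_eq_abs, Real.norm_eq_abs,
      Nat.abs_cast]
    gcongr
    exact hc n
  have hw : w ∈ Metric.ball (0:ℝ) (|w| + 1) := by
    rw [mem_ball_zero_iff, Real.norm_eq_abs]; linarith
  have h := hasDerivAt_tsum_of_isPreconnected (g := fun n y => c n * y ^ n)
    (g' := fun n y => c n * (n * y ^ (n - 1))) hb Metric.isOpen_ball
    (convex_ball (0:ℝ) (|w| + 1)).isPreconnected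
    (fun n y _ => (hasDerivAt_pow n y).const_mul (c n)) hbd hw (dps_summable c hc w) hw
  have hs : Summable (fun n : ℕ => c n * (n * w ^ (n - 1))) :=
    Summable.of_norm_bounded hb (fun n => hbd n w hw)
  have e : (∑' n : ℕ, c n * (n * w ^ (n - 1))) = dps d w := by
    rw [hs.tsum_eq_zero_add]
    simp only [Nat.cast_zero, zero_mul, mul_zero, zero_add, dps]
    refine tsum_congr fun n => ?_
    rw [hd]; push_cast; ring
  rw [e] at h
  exact h

/-- coefficients of f -/
noncomputable def cf (k : ℕ) : ℝ := 1 / (k.factorial : ℝ) ^ 2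
/-- coefficients of the derivative of f -/
noncomputable def cf1 (k : ℕ) : ℝ := 1 / ((k.factorial : ℝ) * ((k + 1).factorial : ℝ))
/-- coefficients of u -/
noncomputable def cu (k : ℕ) : ℝ := Nat.casesOn k 0 cf1
/-- I0 (2 sqrt w) -/
noncomputable def bf (w : ℝ) : ℝ := dps cf w
/-- derivative -/
noncomputable def bf1 (w : ℝ) : ℝ := dps cf1 w

lemma one_le_fact (k : ℕ) : (1 : ℝ) ≤ (k.factorial : ℝ) := by
  exact_mod_cast Nat.one_le_iff_ne_zero.mpr (Nat.factorial_ne_zero k)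

lemma cf_nonneg (k : ℕ) : 0 ≤ cf k := by unfold cf; positivity
lemma cf1_nonneg (k : ℕ) : 0 ≤ cf1 k := by unfold cf1; positivity

lemma cf_bd (k : ℕ) : |cf k| ≤ 1 / (k.factorial : ℝ) := by
  rw [abs_of_nonneg (cf_nonneg k)]
  unfold cf
  have := one_le_fact k
  apply one_div_le_one_div_of_le (by positivity)
  nlinarith

lemma cf1_le (k : ℕ) : cf1 k ≤ cf k := by
  unfold cf cf1
  apply one_div_le_one_div_of_le (by positivity)
  rw [sq]
  gcongr
  omega

lemma cf1_bd (k : ℕ) : |cf1 k| ≤ 1 / (k.factorial : ℝ) := by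
  rw [abs_of_nonneg (cf1_nonneg k)]
  refine (cf1_le k).trans ?_
  have := cf_bd k
  rwa [abs_of_nonneg (cf_nonneg k)] at this

lemma cu_bd (k : ℕ) : |cu k| ≤ 1 / (k.factorial : ℝ) := by
  cases k with
  | zero => simp [cu]
  | succ k =>
    change |cf1 k| ≤ _
    rw [abs_of_nonneg (cf1_nonneg k)]
    unfold cf1
    have := one_le_fact k
    have := one_le_fact (k+1)
    apply one_div_le_one_div_of_le (by positivity)
    nlinarith

lemma bf_hasDerivAt (w : ℝ) : HasDerivAt bf (bf1 w) w := by
  refine dps_hasDerivAt cf cf1 cf_bd ?_ w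
  intro k
  unfold cf cf1
  rw [Nat.factorial_succ]
  push_cast
  have : (k.factorial : ℝ) ≠ 0 := by positivity
  have : (k : ℝ) + 1 ≠ 0 := by positivity
  field_simp

lemma bf1_diff : Differentiable ℝ bf1 := fun w =>
  (dps_hasDerivAt cf1 (fun k => cf1 (k+1) * (k+1)) cf1_bd (fun _ => rfl) w).differentiableAt

lemma bf_diff : Differentiable ℝ bf := fun w => (bf_hasDerivAt w).differentiableAt

lemma bu_eq (w : ℝ) : dps cu w = w * bf1 w := by
  unfold dps bf1 dps
  have h0 : cu 0 = 0 := rfl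
  rw [(dps_summable cu cu_bd w).tsum_eq_zero_add, ← tsum_mul_left, h0, zero_mul, zero_add]
  refine tsum_congr fun n => ?_
  change cf1 n * _ = _
  ring

lemma bu_hasDerivAt (w : ℝ) : HasDerivAt (fun w => w * bf1 w) (bf w) w := by
  have h := dps_hasDerivAt cu cf cu_bd ?_ w
  · have e : dps cu = fun w => w * bf1 w := funext bu_eq
    rw [e] at h; exact h
  intro k
  change _ = cf1 k * _
  unfold cf cf1
  rw [Nat.factorial_succ]
  push_cast
  have : (k.factorial : ℝ) ≠ 0 := by positivity
  have : (k : ℝ) + 1 ≠ 0 := by positivity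
  field_simp

lemma bf_zero : bf 0 = 1 := by
  unfold bf dps
  rw [tsum_eq_single 0]
  · simp [cf]
  · intro k hk; simp [hk]

lemma bf_one_le {w : ℝ} (hw : 0 ≤ w) : 1 ≤ bf w := by
  have := (dps_summable cf cf_bd w).le_tsum 0 (fun k _ => mul_nonneg (cf_nonneg k) (by positivity))
  simpa [cf, bf, dps] using this

lemma bf1_nonneg {w : ℝ} (hw : 0 ≤ w) : 0 ≤ bf1 w :=
  tsum_nonneg (fun k => mul_nonneg (cf1_nonneg k) (by positivity))

lemma bf1_le {w : ℝ} (hw : 0 ≤ w) : bf1 w ≤ bf w :=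
  Summable.tsum_le_tsum (fun k => mul_le_mul_of_nonneg_right (cf1_le k) (by positivity))
    (dps_summable cf1 cf1_bd w) (dps_summable cf cf_bd w)

lemma fact_ineq (k : ℕ) : (2 * k).factorial ≤ 4 ^ k * (k.factorial * k.factorial) := by
  have h := Nat.choose_mul_factorial_mul_factorial (show k ≤ 2 * k by omega)
  have h2 := Nat.choose_le_two_pow (2 * k) k
  rw [pow_mul] at h2
  rw [← h, show 2 * k - k = k by omega, mul_assoc]
  exact Nat.mul_le_mul_right _ h2

lemma bf_sq_le (z : ℝ) : bf (z ^ 2) ≤ Real.exp (2 * |z|) := by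
  have h := Real.hasSum_cosh (2 * |z|)
  have h1 : bf (z ^ 2) ≤ Real.cosh (2 * |z|) := by
    rw [← h.tsum_eq]
    refine Summable.tsum_le_tsum (fun k => ?_) (dps_summable cf cf_bd _) h.summable
    have hk : ((2 * k).factorial : ℝ) ≤ 4 ^ k * (k.factorial * k.factorial) := by
      exact_mod_cast fact_ineq k
    have e : (2 * |z|) ^ (2 * k) = 4 ^ k * (z ^ 2) ^ k := by
      rw [pow_mul, mul_pow, sq_abs, mul_pow]; norm_num
    rw [e, cf, one_div_mul_eq_div, div_le_div_iff₀ (by positivity) (by positivity)]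
    calc (z ^ 2) ^ k * ((2 * k).factorial : ℝ)
        ≤ (z ^ 2) ^ k * (4 ^ k * (k.factorial * k.factorial)) := by gcongr
      _ = _ := by ring
  refine h1.trans ?_
  rw [Real.cosh_eq]
  have : Real.exp (-(2 * |z|)) ≤ Real.exp (2 * |z|) :=
    Real.exp_le_exp.mpr (by linarith [abs_nonneg z])
  linarith

lemma besselI0_eq (w : ℝ) (hw : 0 ≤ w) : besselI0 (2 * Real.sqrt w) = bf w := by
  unfold besselI0 bf dps cf
  refine tsum_congr fun k => ?_
  rw [mul_pow, Real.sq_sqrt hw]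
  ring

/-- conditional density kernel -/
noncomputable def kG (t s x : ℝ) : ℝ :=
  x⁻¹ * Real.exp (-(s ^ 2 + t ^ 2) / x) * bf ((s * t / x) ^ 2)
/-- s-derivative of kG -/
noncomputable def kG1 (t s x : ℝ) : ℝ :=
  x⁻¹ * Real.exp (-(s ^ 2 + t ^ 2) / x) *
    (-(2 * s / x) * bf ((s * t / x) ^ 2) + 2 * s * t ^ 2 / x ^ 2 * bf1 ((s * t / x) ^ 2))
/-- x-derivative of kG -/
noncomputable def kGx (t s x : ℝ) : ℝ :=
  x⁻¹ ^ 2 * Real.exp (-(s ^ 2 + t ^ 2) / x) *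
    (((s ^ 2 + t ^ 2) / x - 1) * bf ((s * t / x) ^ 2)
      - 2 * ((s * t / x) ^ 2 * bf1 ((s * t / x) ^ 2)))

lemma kG_deriv_s (t s x : ℝ) : HasDerivAt (fun s => kG t s x) (kG1 t s x) s := by
  unfold kG kG1
  have h1 : HasDerivAt (fun s : ℝ => -(s ^ 2 + t ^ 2) / x) (-(2 * s) / x) s := by
    have := (((hasDerivAt_pow 2 s).add_const (t ^ 2)).neg).div_const x
    refine this.congr_deriv ?_; simp
  have h2 : HasDerivAt (fun s : ℝ => (s * t / x) ^ 2) (2 * s * t ^ 2 / x ^ 2) s := by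
    have := (((hasDerivAt_id s).mul_const t).div_const x).pow 2
    refine this.congr_deriv ?_; simp; ring
  have h3 := (bf_hasDerivAt ((s * t / x) ^ 2)).comp s h2
  refine HasDerivAt.congr_deriv ((h1.exp.const_mul x⁻¹).mul h3) ?_
  ring

lemma kP_deriv_s (t s x : ℝ) : HasDerivAt (fun s => s * kG1 t s x) (4 * s * kGx t s x) s := by
  have h1 : HasDerivAt (fun s : ℝ => -(s ^ 2 + t ^ 2) / x) (-(2 * s) / x) s := by
    have := (((hasDerivAt_pow 2 s).add_const (t ^ 2)).neg).div_const x
    refine this.congr_deriv ?_; simp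
  have h2 : HasDerivAt (fun s : ℝ => (s * t / x) ^ 2) (2 * s * t ^ 2 / x ^ 2) s := by
    have := (((hasDerivAt_id s).mul_const t).div_const x).pow 2
    refine this.congr_deriv ?_; simp; ring
  have h3 := (bf_hasDerivAt ((s * t / x) ^ 2)).comp s h2
  have h4 := (bu_hasDerivAt ((s * t / x) ^ 2)).comp s h2
  have h5 : HasDerivAt (fun s : ℝ => -(2 * s ^ 2 / x)) (-(4 * s / x)) s := by
    have := (((hasDerivAt_pow 2 s).const_mul 2).div_const x).neg
    refine this.congr_deriv ?_; simp; ring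
  have h6 := (h1.exp.const_mul x⁻¹).mul ((h5.mul h3).add (h4.const_mul 2))
  have e : (fun s => s * kG1 t s x) = ((fun s : ℝ => x⁻¹ * Real.exp (-(s ^ 2 + t ^ 2) / x)) *
      ((fun s : ℝ => -(2 * s ^ 2 / x)) * (bf ∘ fun s : ℝ => (s * t / x) ^ 2) +
        fun y => 2 * ((fun w => w * bf1 w) ∘ fun s : ℝ => (s * t / x) ^ 2) y)) := by
    funext s
    simp only [kG1, Function.comp, Pi.mul_apply, Pi.add_apply]
    ring
  rw [e]
  refine HasDerivAt.congr_deriv (h6) ?_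
  simp only [Function.comp, kGx, Pi.mul_apply, Pi.add_apply]
  ring

lemma kG_deriv_x (t s x : ℝ) (hx : 0 < x) : HasDerivAt (fun x => kG t s x) (kGx t s x) x := by
  unfold kG kGx
  have h0 := hasDerivAt_inv hx.ne'
  have h1 : HasDerivAt (fun x : ℝ => -(s ^ 2 + t ^ 2) / x) ((s ^ 2 + t ^ 2) / x ^ 2) x := by
    have := h0.const_mul (-(s ^ 2 + t ^ 2))
    refine this.congr_deriv ?_; ring
  have h2 : HasDerivAt (fun x : ℝ => (s * t / x) ^ 2) (-2 * (s * t) ^ 2 / x ^ 3) x := by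
    have := (h0.const_mul (s * t)).pow 2
    refine this.congr_deriv ?_
    simp; field_simp
  have h3 := (bf_hasDerivAt ((s * t / x) ^ 2)).comp x h2
  refine HasDerivAt.congr_deriv ((h0.mul h1.exp).mul h3) ?_
  simp only [Function.comp, Pi.mul_apply]
  field_simp
  ring

lemma exp_bf_le {t s r x : ℝ} (hs : |s| ≤ r) (hr : r < t) (hx : 0 < x) :
    Real.exp (-(s ^ 2 + t ^ 2) / x) * bf ((s * t / x) ^ 2) ≤ Real.exp (-((t - r) ^ 2 / x)) := by
  have h0 := abs_nonneg s
  have ht : 0 < t := by linarith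
  calc _ ≤ Real.exp (-(s ^ 2 + t ^ 2) / x) * Real.exp (2 * |s * t / x|) := by
        gcongr; exact bf_sq_le _
    _ = Real.exp (-((t - |s|) ^ 2 / x)) := by
        rw [← Real.exp_add, abs_div, abs_mul, abs_of_pos ht, abs_of_pos hx, ← sq_abs s]
        congr 1; ring
    _ ≤ _ := by
        apply Real.exp_le_exp.mpr
        apply neg_le_neg
        gcongr

lemma exp_inv_le {δ x : ℝ} (hδ : 0 < δ) (hx : 0 < x) (n : ℕ) :
    x⁻¹ ^ n * Real.exp (-(δ / x)) ≤ n.factorial / δ ^ n := by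
  have h := Real.pow_div_factorial_le_exp (δ / x) (by positivity) n
  rw [Real.exp_neg, ← div_eq_mul_inv, div_le_div_iff₀ (by positivity) (by positivity)]
  rw [div_le_iff₀ (by positivity)] at h
  calc x⁻¹ ^ n * δ ^ n = (δ / x) ^ n := by rw [← mul_pow]; congr 1; field_simp
    _ ≤ _ := by rw [mul_comm]; exact h

lemma kG_bd {t s r x : ℝ} (hs : |s| ≤ r) (hr : r < t) (hx : 0 < x) :
    |kG t s x| ≤ x * (2 / ((t - r) ^ 2) ^ 2) ∧ |kG t s x| ≤ 1 / ((t - r) ^ 2) := by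
  have hδ : 0 < (t - r) ^ 2 := by have : 0 < t - r := by linarith
                                  positivity
  have h := exp_bf_le hs hr hx
  have hb := bf_one_le (sq_nonneg (s * t / x))
  have h1 := exp_inv_le hδ hx 1
  have h2 := exp_inv_le hδ hx 2
  have hk : |kG t s x| ≤ x⁻¹ * Real.exp (-((t - r) ^ 2 / x)) := by
    unfold kG
    rw [abs_of_nonneg (by positivity), mul_assoc]
    gcongr
  simp only [Nat.factorial, pow_one] at h1 h2
  refine ⟨hk.trans ?_, hk.trans (by simpa using h1)⟩
  calc x⁻¹ * Real.exp (-((t - r) ^ 2 / x)) = x * (x⁻¹ ^ 2 * Real.exp (-((t - r) ^ 2 / x))) := by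
        field_simp
    _ ≤ _ := by gcongr; simpa using h2

lemma kG1_bd {t r : ℝ} (hr0 : 0 ≤ r) (hr : r < t) : ∃ C, ∀ s x, |s| ≤ r → 0 < x →
    |kG1 t s x| ≤ C := by
  have hδ : 0 < (t - r) ^ 2 := by have : 0 < t - r := by linarith
                                  positivity
  refine ⟨2 * r * ((2 : ℕ).factorial / ((t - r) ^ 2) ^ 2) +
    2 * r * t ^ 2 * ((3 : ℕ).factorial / ((t - r) ^ 2) ^ 3), fun s x hs hx => ?_⟩
  have h := exp_bf_le hs hr hx
  have hw := sq_nonneg (s * t / x)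
  have hb := bf_one_le hw
  have hb1 := bf1_nonneg hw
  have hb2 := bf1_le hw
  have h2 := exp_inv_le hδ hx 2
  have h3 := exp_inv_le hδ hx 3
  have A : |-(2 * s / x) * bf ((s * t / x) ^ 2) + 2 * s * t ^ 2 / x ^ 2 * bf1 ((s * t / x) ^ 2)|
      ≤ (2 * r * x⁻¹ + 2 * r * t ^ 2 * x⁻¹ ^ 2) * bf ((s * t / x) ^ 2) := by
    refine (abs_add_le _ _).trans ?_
    rw [abs_mul, abs_mul, abs_of_nonneg hb1, abs_of_nonneg (by linarith : 0 ≤ bf ((s * t / x) ^ 2)),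
      add_mul]
    have e1 : |-(2 * s / x)| = 2 * |s| * x⁻¹ := by
      rw [abs_neg, abs_div, abs_mul, abs_of_pos hx, abs_two]; rfl
    have e2 : |2 * s * t ^ 2 / x ^ 2| = 2 * |s| * t ^ 2 * x⁻¹ ^ 2 := by
      rw [abs_div, abs_mul, abs_mul, abs_two, abs_of_nonneg (sq_nonneg t),
        abs_of_nonneg (sq_nonneg x), inv_pow]; rfl
    rw [e1, e2]
    gcongr
  unfold kG1
  rw [abs_mul, abs_of_nonneg (by positivity : 0 ≤ x⁻¹ * Real.exp (-(s ^ 2 + t ^ 2) / x))]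
  calc _ ≤ x⁻¹ * Real.exp (-(s ^ 2 + t ^ 2) / x) *
          ((2 * r * x⁻¹ + 2 * r * t ^ 2 * x⁻¹ ^ 2) * bf ((s * t / x) ^ 2)) := by gcongr
    _ = x⁻¹ * (2 * r * x⁻¹ + 2 * r * t ^ 2 * x⁻¹ ^ 2) *
          (Real.exp (-(s ^ 2 + t ^ 2) / x) * bf ((s * t / x) ^ 2)) := by ring
    _ ≤ x⁻¹ * (2 * r * x⁻¹ + 2 * r * t ^ 2 * x⁻¹ ^ 2) * Real.exp (-((t - r) ^ 2 / x)) := by gcongr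
    _ = 2 * r * (x⁻¹ ^ 2 * Real.exp (-((t - r) ^ 2 / x))) +
        2 * r * t ^ 2 * (x⁻¹ ^ 3 * Real.exp (-((t - r) ^ 2 / x))) := by ring
    _ ≤ _ := by gcongr

lemma kGx_bd {t r : ℝ} (hr0 : 0 ≤ r) (hr : r < t) : ∃ C, ∀ s x, |s| ≤ r → 0 < x →
    |kGx t s x| ≤ C := by
  have hδ : 0 < (t - r) ^ 2 := by have : 0 < t - r := by linarith
                                  positivity
  have ht : 0 < t := by linarith
  refine ⟨(r ^ 2 + t ^ 2) * ((3 : ℕ).factorial / ((t - r) ^ 2) ^ 3) +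
    ((2 : ℕ).factorial / ((t - r) ^ 2) ^ 2) +
    2 * (r * t) ^ 2 * ((4 : ℕ).factorial / ((t - r) ^ 2) ^ 4), fun s x hs hx => ?_⟩
  have h := exp_bf_le hs hr hx
  have hw := sq_nonneg (s * t / x)
  have hb := bf_one_le hw
  have hb1 := bf1_nonneg hw
  have hb2 := bf1_le hw
  have h2 := exp_inv_le hδ hx 2
  have h3 := exp_inv_le hδ hx 3
  have h4 := exp_inv_le hδ hx 4
  have hs2 : s ^ 2 ≤ r ^ 2 := by rw [← sq_abs]; gcongr
  have A : |((s ^ 2 + t ^ 2) / x - 1) * bf ((s * t / x) ^ 2)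
      - 2 * ((s * t / x) ^ 2 * bf1 ((s * t / x) ^ 2))|
      ≤ ((r ^ 2 + t ^ 2) * x⁻¹ + 1 + 2 * (r * t) ^ 2 * x⁻¹ ^ 2) * bf ((s * t / x) ^ 2) := by
    refine (abs_sub _ _).trans ?_
    rw [abs_mul, abs_of_nonneg (by linarith : 0 ≤ bf ((s * t / x) ^ 2)),
      add_mul, abs_of_nonneg (by positivity : 0 ≤ 2 * ((s * t / x) ^ 2 * bf1 ((s * t / x) ^ 2)))]
    have e1 : |(s ^ 2 + t ^ 2) / x - 1| ≤ (s ^ 2 + t ^ 2) * x⁻¹ + 1 := by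
      refine (abs_sub _ _).trans ?_
      rw [abs_one, abs_of_nonneg (by positivity)]; rfl
    have e2 : 2 * ((s * t / x) ^ 2 * bf1 ((s * t / x) ^ 2)) =
       2 * (s ^ 2 * t ^ 2) * x⁻¹ ^ 2 * bf1 ((s * t / x) ^ 2) := by ring
    rw [e2, mul_pow]
    have e3 : (s ^ 2 + t ^ 2) * x⁻¹ + 1 ≤ (r ^ 2 + t ^ 2) * x⁻¹ + 1 := by gcongr
    have e4 := e1.trans e3
    gcongr
  unfold kGx
  rw [abs_mul, abs_of_nonneg (by positivity : 0 ≤ x⁻¹ ^ 2 * Real.exp (-(s ^ 2 + t ^ 2) / x))]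
  calc _ ≤ x⁻¹ ^ 2 * Real.exp (-(s ^ 2 + t ^ 2) / x) *
          (((r ^ 2 + t ^ 2) * x⁻¹ + 1 + 2 * (r * t) ^ 2 * x⁻¹ ^ 2) * bf ((s * t / x) ^ 2)) := by
            gcongr
    _ = x⁻¹ ^ 2 * ((r ^ 2 + t ^ 2) * x⁻¹ + 1 + 2 * (r * t) ^ 2 * x⁻¹ ^ 2) *
          (Real.exp (-(s ^ 2 + t ^ 2) / x) * bf ((s * t / x) ^ 2)) := by ring
    _ ≤ x⁻¹ ^ 2 * ((r ^ 2 + t ^ 2) * x⁻¹ + 1 + 2 * (r * t) ^ 2 * x⁻¹ ^ 2) *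
          Real.exp (-((t - r) ^ 2 / x)) := by gcongr
    _ = (r ^ 2 + t ^ 2) * (x⁻¹ ^ 3 * Real.exp (-((t - r) ^ 2 / x))) +
        (x⁻¹ ^ 2 * Real.exp (-((t - r) ^ 2 / x))) +
        2 * (r * t) ^ 2 * (x⁻¹ ^ 4 * Real.exp (-((t - r) ^ 2 / x))) := by ring
    _ ≤ _ := by gcongr

lemma bf_meas : Measurable bf := bf_diff.continuous.measurable
lemma bf1_meas : Measurable bf1 := bf1_diff.continuous.measurable

lemma kG_meas (t s : ℝ) : Measurable (kG t s) := by
  have := bf_meas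
  unfold kG; fun_prop
lemma kG1_meas (t s : ℝ) : Measurable (kG1 t s) := by
  have := bf_meas
  have := bf1_meas
  unfold kG1; fun_prop
lemma kGx_meas (t s : ℝ) : Measurable (kGx t s) := by
  have := bf_meas
  have := bf1_meas
  unfold kGx; fun_prop

lemma int_of_bd {h : ℝ → ℝ} (hm : Measurable h) (C : ℝ) (hC : ∀ x, 0 < x → |h x| ≤ C) :
    IntegrableOn (fun x => Real.exp (-x) * h x) (Set.Ioi 0) := by
  have hi : Integrable (fun x => Real.exp (-x) * C) (volume.restrict (Set.Ioi 0)) :=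
    (integrableOn_exp_neg_Ioi 0).mul_const C
  refine hi.mono' (by fun_prop) ?_
  refine (ae_restrict_iff' measurableSet_Ioi).mpr (Filter.Eventually.of_forall fun x hx => ?_)
  rw [norm_mul, Real.norm_eq_abs, Real.norm_eq_abs, Real.abs_exp]
  exact mul_le_mul_of_nonneg_left (hC x hx) (by positivity)

/-- differentiation under the integral -/
lemma param_deriv {h h' : ℝ → ℝ → ℝ} {t : ℝ} (hm : ∀ s, Measurable (h s))
    (hm' : ∀ s, Measurable (h' s))
    (hd : ∀ s x, HasDerivAt (fun s => h s x) (h' s x) s)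
    (hb : ∀ r, 0 ≤ r → r < t → ∃ C, ∀ s x, |s| ≤ r → 0 < x → |h s x| ≤ C)
    (hb' : ∀ r, 0 ≤ r → r < t → ∃ C, ∀ s x, |s| ≤ r → 0 < x → |h' s x| ≤ C)
    (s : ℝ) (hs : |s| < t) :
    HasDerivAt (fun s => ∫ x in Set.Ioi 0, Real.exp (-x) * h s x)
      (∫ x in Set.Ioi 0, Real.exp (-x) * h' s x) s := by
  have h0 := abs_nonneg s
  obtain ⟨r, hr1, hr2⟩ := exists_between hs
  obtain ⟨C, hC⟩ := hb r (by linarith) hr2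
  obtain ⟨C', hC'⟩ := hb' r (by linarith) hr2
  have hnb : Metric.ball (0:ℝ) r ∈ nhds s := Metric.isOpen_ball.mem_nhds (by
    rw [mem_ball_zero_iff, Real.norm_eq_abs]; exact hr1)
  refine (hasDerivAt_integral_of_dominated_loc_of_deriv_le
    (F := fun s x => Real.exp (-x) * h s x) (F' := fun s x => Real.exp (-x) * h' s x)
    (bound := fun x => Real.exp (-x) * C') hnb ?_ ?_ ?_ ?_ ?_ ?_).2
  · refine Filter.Eventually.of_forall fun s => ?_
    have := hm s
    fun_prop
  · exact int_of_bd (hm s) C (fun x hx => hC s x hr1.le hx)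
  · have := hm' s
    fun_prop
  · refine (ae_restrict_iff' measurableSet_Ioi).mpr (Filter.Eventually.of_forall fun x hx y hy => ?_)
    rw [mem_ball_zero_iff, Real.norm_eq_abs] at hy
    rw [norm_mul, Real.norm_eq_abs, Real.norm_eq_abs, Real.abs_exp]
    exact mul_le_mul_of_nonneg_left (hC' y x hy.le hx) (by positivity)
  · exact (integrableOn_exp_neg_Ioi 0).mul_const C'
  · exact Filter.Eventually.of_forall fun x y _ => (hd y x).const_mul _

/-- the integral -/
noncomputable def kF (t s : ℝ) : ℝ := ∫ x in Set.Ioi 0, Real.exp (-x) * kG t s x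
/-- its derivative -/
noncomputable def kF1 (t s : ℝ) : ℝ := ∫ x in Set.Ioi 0, Real.exp (-x) * kG1 t s x

lemma kF_deriv {t s : ℝ} (hs : |s| < t) : HasDerivAt (kF t) (kF1 t s) s :=
  param_deriv (kG_meas t) (kG1_meas t) (kG_deriv_s t)
    (fun r _ hr => ⟨_, fun _ _ hs hx => (kG_bd hs hr hx).2⟩)
    (fun _ h0 hr => kG1_bd h0 hr) s hs

lemma by_parts {t s : ℝ} (hs : |s| < t) :
    ∫ x in Set.Ioi 0, Real.exp (-x) * kGx t s x = kF t s := by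
  obtain ⟨C, hC⟩ := kGx_bd (abs_nonneg s) hs
  have i1 := int_of_bd (kGx_meas t s) C (fun x hx => hC s x le_rfl hx)
  have i2 := int_of_bd (kG_meas t s) _ (fun x hx => (kG_bd le_rfl hs hx).2)
  have hz : kG t s 0 = 0 := by simp [kG]
  have h := integral_Ioi_of_hasDerivAt_of_tendsto (a := 0) (m := 0)
    (f := fun x => Real.exp (-x) * kG t s x)
    (f' := fun x => Real.exp (-x) * kGx t s x - Real.exp (-x) * kG t s x) ?_ ?_ (i1.sub i2) ?_
  · rw [integral_sub i1 i2] at h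
    simp only [hz, mul_zero, sub_zero] at h
    unfold kF
    linarith
  · unfold ContinuousWithinAt
    simp only [hz, mul_zero]
    have hlim : Filter.Tendsto (fun x : ℝ => x * (2 / ((t - |s|) ^ 2) ^ 2))
        (nhdsWithin 0 (Set.Ici 0)) (nhds 0) := by
      have : Continuous (fun x : ℝ => x * (2 / ((t - |s|) ^ 2) ^ 2)) := by fun_prop
      have := this.tendsto 0
      simp only [zero_mul] at this
      exact this.mono_left nhdsWithin_le_nhds
    refine squeeze_zero_norm' ?_ hlim
    filter_upwards [self_mem_nhdsWithin] with x hx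
    rcases (Set.mem_Ici.mp hx).eq_or_lt with h0 | h0
    · simp [← h0, hz]
    · rw [norm_mul, Real.norm_eq_abs, Real.norm_eq_abs, Real.abs_exp]
      have e1 : Real.exp (-x) ≤ 1 := Real.exp_le_one_iff.mpr (by linarith)
      have e2 := (kG_bd le_rfl hs h0).1
      have := abs_nonneg (kG t s x)
      nlinarith
  · intro x hx
    have h1 : HasDerivAt (fun x : ℝ => Real.exp (-x)) (-Real.exp (-x)) x := by
      refine HasDerivAt.congr_deriv ((hasDerivAt_neg x).exp) ?_
      ring
    refine HasDerivAt.congr_deriv (h1.mul (kG_deriv_x t s x hx)) ?_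
    ring
  · have hlim : Filter.Tendsto (fun x : ℝ => Real.exp (-x) * (1 / (t - |s|) ^ 2))
        Filter.atTop (nhds 0) := by
      have := Real.tendsto_exp_neg_atTop_nhds_zero.mul_const (1 / (t - |s|) ^ 2)
      simpa using this
    refine squeeze_zero_norm' ?_ hlim
    filter_upwards [Filter.eventually_gt_atTop 0] with x hx
    rw [norm_mul, Real.norm_eq_abs, Real.norm_eq_abs, Real.abs_exp]
    exact mul_le_mul_of_nonneg_left (kG_bd le_rfl hs hx).2 (by positivity)

lemma kQ_deriv {t s : ℝ} (hs : |s| < t) :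
    HasDerivAt (fun s => s * kF1 t s) (4 * s * kF t s) s := by
  have h := param_deriv (h := fun s x => s * kG1 t s x) (h' := fun s x => 4 * s * kGx t s x)
    (t := t) (fun s => (kG1_meas t s).const_mul s) (fun s => (kGx_meas t s).const_mul _)
    (kP_deriv_s t) ?_ ?_ s hs
  · have e1 : (fun s => ∫ x in Set.Ioi 0, Real.exp (-x) * (s * kG1 t s x)) =
        fun s => s * kF1 t s := by
      funext s
      rw [kF1, ← integral_const_mul]
      congr 1; funext x; ring
    have e2 : (∫ x in Set.Ioi 0, Real.exp (-x) * (4 * s * kGx t s x)) = 4 * s * kF t s := by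
      rw [← by_parts hs, ← integral_const_mul]
      congr 1; funext x; ring
    rw [e1, e2] at h
    exact h
  · intro r h0 hr
    obtain ⟨C, hC⟩ := kG1_bd h0 hr
    refine ⟨r * C, fun s x hs hx => ?_⟩
    rw [abs_mul]
    exact mul_le_mul hs (hC s x hs hx) (abs_nonneg _) h0
  · intro r h0 hr
    obtain ⟨C, hC⟩ := kGx_bd h0 hr
    refine ⟨4 * r * C, fun s x hs hx => ?_⟩
    rw [abs_mul, abs_mul, abs_of_pos (by norm_num : (0:ℝ) < 4)]
    have := hC s x hs hx
    gcongr

lemma kF_eq {t s : ℝ} (hs : |s| < t) : kF t s = bf (s ^ 2) * kF t 0 := by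
  have hI : ∀ s, HasDerivAt (fun s : ℝ => bf (s ^ 2)) (2 * s * bf1 (s ^ 2)) s := by
    intro s
    refine HasDerivAt.congr_deriv ((bf_hasDerivAt (s ^ 2)).comp s (hasDerivAt_pow 2 s)) ?_
    simp; ring
  have hJ : ∀ s, HasDerivAt (fun s : ℝ => 2 * (s ^ 2 * bf1 (s ^ 2))) (4 * s * bf (s ^ 2)) s := by
    intro s
    have h := ((bu_hasDerivAt (s ^ 2)).comp s (hasDerivAt_pow 2 s)).const_mul 2
    refine HasDerivAt.congr_deriv h ?_
    simp; ring
  have hpos : ∀ s : ℝ, bf (s ^ 2) ≠ 0 := fun s => by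
    have := bf_one_le (sq_nonneg s); linarith
  have h00 := abs_nonneg s
  have hmem : ∀ y, y ∈ Metric.ball (0:ℝ) t ↔ |y| < t := fun y => by
    rw [mem_ball_zero_iff, Real.norm_eq_abs]
  have m0 : (0:ℝ) ∈ Metric.ball (0:ℝ) t := by rw [hmem]; simp; linarith
  have hpc := (convex_ball (0:ℝ) t).isPreconnected
  have hW : ∀ y, |y| < t → HasDerivAt
      (fun s => s * kF1 t s * bf (s ^ 2) - kF t s * (2 * (s ^ 2 * bf1 (s ^ 2)))) 0 y := by
    intro y hy
    refine HasDerivAt.congr_deriv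
      (((kQ_deriv hy).mul (hI y)).sub ((kF_deriv hy).mul (hJ y))) ?_
    ring
  have hW0 : ∀ y, |y| < t →
      y * kF1 t y * bf (y ^ 2) - kF t y * (2 * (y ^ 2 * bf1 (y ^ 2))) = 0 := by
    intro y hy
    have := Metric.isOpen_ball.is_const_of_deriv_eq_zero hpc
      (fun y hy => (hW y ((hmem y).1 hy)).differentiableAt.differentiableWithinAt)
      (fun y hy => (hW y ((hmem y).1 hy)).deriv) ((hmem y).2 hy) m0
    simpa using this
  have hR : ∀ y, |y| < t → HasDerivAt (fun s => kF t s / bf (s ^ 2)) 0 y := by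
    intro y hy
    refine HasDerivAt.congr_deriv ((kF_deriv hy).div (hI y) (hpos y)) ?_
    rw [div_eq_zero_iff]
    left
    by_cases h0 : y = 0
    · subst h0
      simp [kF1, kG1]
    · have := hW0 y hy
      apply mul_left_cancel₀ h0
      linear_combination this
  have := Metric.isOpen_ball.is_const_of_deriv_eq_zero hpc
      (fun y hy => (hR y ((hmem y).1 hy)).differentiableAt.differentiableWithinAt)
      (fun y hy => (hR y ((hmem y).1 hy)).deriv) ((hmem s).2 hs) m0
  simp only [ne_eq, OfNat.ofNat_ne_zero, not_false_eq_true, zero_pow, bf_zero, div_one] at this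
  rw [div_eq_iff (hpos s)] at this
  rw [this]; ring

lemma kF_zero {t : ℝ} (ht : 0 < t) : kF t 0 = 2 * besselK0 (2 * t) := by
  have him : (fun v : ℝ => t * Real.exp v) '' Set.univ = Set.Ioi 0 := by
    ext x
    simp only [Set.image_univ, Set.mem_range, Set.mem_Ioi]
    constructor
    · rintro ⟨v, rfl⟩; positivity
    · intro hx
      refine ⟨Real.log (x / t), ?_⟩
      rw [Real.exp_log (by positivity)]; field_simp
  have h := integral_image_eq_integral_abs_deriv_smul (s := Set.univ)
    (f := fun v : ℝ => t * Real.exp v) (f' := fun v : ℝ => t * Real.exp v) MeasurableSet.univ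
    (fun v _ => ((Real.hasDerivAt_exp v).const_mul t).hasDerivWithinAt)
    (fun a _ b _ hab => Real.exp_injective (mul_left_cancel₀ ht.ne' hab))
    (fun x => Real.exp (-x) * kG t 0 x)
  rw [him] at h
  unfold kF besselK0
  rw [h, ← integral_comp_abs (f := fun v => Real.exp (-(2 * t) * Real.cosh v)),
    Measure.restrict_univ]
  congr 1
  funext v
  have hv := Real.exp_pos v
  rw [Real.cosh_abs, abs_of_pos (by positivity), smul_eq_mul]
  simp only [kG, zero_mul, zero_div, ne_eq, OfNat.ofNat_ne_zero, not_false_eq_true, zero_pow,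
    bf_zero, mul_one, zero_add]
  have e : Real.exp (-(t * Real.exp v)) * Real.exp (-t ^ 2 / (t * Real.exp v)) =
      Real.exp (-(2 * t) * Real.cosh v) := by
    rw [← Real.exp_add, Real.cosh_eq, Real.exp_neg]
    congr 1
    field_simp
    ring
  rw [← e]
  field_simp

lemma main_int {a b : ℝ} (ha : 0 < a) (hab : a < b) :
    ∫ x in Set.Ioi (0:ℝ), Real.exp (-x) * kG (Real.sqrt b) (Real.sqrt a) x =
      2 * besselI0 (2 * Real.sqrt a) * besselK0 (2 * Real.sqrt b) := by
  have hs : |Real.sqrt a| < Real.sqrt b := by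
    rw [abs_of_nonneg (Real.sqrt_nonneg a)]
    exact Real.sqrt_lt_sqrt ha.le hab
  have := kF_eq hs
  rw [kF_zero (Real.sqrt_pos.mpr (ha.trans hab)), Real.sq_sqrt ha.le, ← besselI0_eq a ha.le] at this
  unfold kF at this
  rw [this]; ring

lemma integrand_eq (γbar β γ x : ℝ) (hγbar : 0 < γbar) (hβ0 : 0 < β) (hβ1 : β < 1) (hγ : 0 < γ)
    (hx : 0 < x) :
    (1 / ((1 - β) * x * γbar)) *
            Real.exp (-(γ + β * γbar) / ((1 - β) * x * γbar)) *
            besselI0 ((2 / ((1 - β) * x)) * Real.sqrt (β * γ / γbar)) *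
            Real.exp (-x) =
    1 / ((1 - β) * γbar) * (Real.exp (-x) *
      kG (Real.sqrt (β / (1 - β))) (Real.sqrt (γ / ((1 - β) * γbar))) x) := by
  have h1 : 0 < 1 - β := by linarith
  unfold kG
  rw [Real.sq_sqrt (by positivity), Real.sq_sqrt (by positivity), div_pow, mul_pow,
    Real.sq_sqrt (by positivity), Real.sq_sqrt (by positivity)]
  have e : (2 / ((1 - β) * x)) * Real.sqrt (β * γ / γbar) =
      2 * Real.sqrt (γ / ((1 - β) * γbar) * (β / (1 - β)) / x ^ 2) := by
    have : γ / ((1 - β) * γbar) * (β / (1 - β)) / x ^ 2 =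
      (1 / ((1 - β) * x)) ^ 2 * (β * γ / γbar) := by field_simp
    rw [this, Real.sqrt_mul (by positivity), Real.sqrt_sq (by positivity)]
    ring
  rw [e, besselI0_eq _ (by positivity)]
  have e2 : -(γ + β * γbar) / ((1 - β) * x * γbar) =
      -(γ / ((1 - β) * γbar) + β / (1 - β)) / x := by field_simp
  rw [e2]
  field_simp

lemma kG_symm (t s x : ℝ) : kG t s x = kG s t x := by
  unfold kG
  rw [add_comm, mul_comm s t]

/-- **Double-Rayleigh plus LOS PDF.** For `γ̄ > 0` and `0 < β < 1`, the exponential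
mixture of conditional Rician densities has the stated piecewise closed form:
an `I₀·K₀` product for `0 < γ < βγ̄` and a `K₀·I₀` product for `γ > βγ̄`. -/
theorem drlos_pdf (γbar β : ℝ) (hγbar : 0 < γbar) (hβ0 : 0 < β) (hβ1 : β < 1) :
    (∀ γ : ℝ, 0 < γ → γ < β * γbar →
      ∫ x in Set.Ioi (0 : ℝ),
          (1 / ((1 - β) * x * γbar)) *
            Real.exp (-(γ + β * γbar) / ((1 - β) * x * γbar)) *
            besselI0 ((2 / ((1 - β) * x)) * Real.sqrt (β * γ / γbar)) *
            Real.exp (-x)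
        = (2 / ((1 - β) * γbar)) * besselI0 (2 * Real.sqrt (γ / ((1 - β) * γbar))) *
            besselK0 (2 * Real.sqrt (β / (1 - β)))) ∧
    (∀ γ : ℝ, β * γbar < γ →
      ∫ x in Set.Ioi (0 : ℝ),
          (1 / ((1 - β) * x * γbar)) *
            Real.exp (-(γ + β * γbar) / ((1 - β) * x * γbar)) *
            besselI0 ((2 / ((1 - β) * x)) * Real.sqrt (β * γ / γbar)) *
            Real.exp (-x)
        = (2 / ((1 - β) * γbar)) * besselK0 (2 * Real.sqrt (γ / ((1 - β) * γbar))) *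
            besselI0 (2 * Real.sqrt (β / (1 - β)))) := by
  have h1 : 0 < 1 - β := by linarith
  constructor
  · intro γ hγ hlt
    rw [setIntegral_congr_fun measurableSet_Ioi
      (fun x hx => integrand_eq γbar β γ x hγbar hβ0 hβ1 hγ hx), integral_const_mul, main_int]
    · ring
    · positivity
    · rw [div_lt_div_iff₀ (by positivity) h1]
      nlinarith
  · intro γ hlt
    have hγ : 0 < γ := lt_trans (by positivity) hlt
    rw [setIntegral_congr_fun measurableSet_Ioi
      (fun x hx => integrand_eq γbar β γ x hγbar hβ0 hβ1 hγ hx), integral_const_mul]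
    simp only [kG_symm (Real.sqrt (β / (1 - β)))]
    rw [main_int]
    · ring
    · positivity
    · rw [div_lt_div_iff₀ h1 (by positivity)]
      nlinarith
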